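/- For all n ≥ 5, the number f_n^1(σ) of permutations π ∈ S_n with θ(π) = π that avoid σ equals: F_{n+1} if σ ∈ {231, 312, 321}; 2 if σ ∈ {132, 213}; and 0 if σ = 123. -/

import Mathlib

/-- The one-line word of the image of `π` under the fundamental bijection:
write `π` in standard cycle form (every cycle written with its largest element
first, cycles listed in increasing order of their largest elements) and erase
the parentheses.  The cycle maxima are exactly the `x` with `π^[k] x ≤ x` for
all `k`, and the cycle of `x` is `x, π x, π² x, …` up to the period of `x`. -/
noncomputable def fundWord {n : ℕ} (π : Equiv.Perm (Fin n)) : List (Fin n) :=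
  ((List.finRange n).filter fun x => (List.range n).all fun k => decide ((⇑π)^[k] x ≤ x)).flatMap
    fun x => (List.range (Function.minimalPeriod (⇑π) x)).map fun k => (⇑π)^[k] x

/-- The permutation whose one-line notation is the word `w`
(junk value if `w` is not the one-line notation of a permutation). -/
noncomputable def permOfWord {n : ℕ} (w : List (Fin n)) : Equiv.Perm (Fin n) :=
  Function.invFun (fun σ : Equiv.Perm (Fin n) => (List.finRange n).map ⇑σ) w

/-- The fundamental bijection `θ`. -/
noncomputable def theta {n : ℕ} (π : Equiv.Perm (Fin n)) : Equiv.Perm (Fin n) :=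
  permOfWord (fundWord π)

/-- `π` contains the pattern `σ`. -/
def Contains {k n : ℕ} (σ : Equiv.Perm (Fin k)) (π : Equiv.Perm (Fin n)) : Prop :=
  ∃ f : Fin k → Fin n, StrictMono f ∧ ∀ a b : Fin k, π (f a) < π (f b) ↔ σ a < σ b

/-- `π` avoids the pattern `σ`. -/
def Avoids {k n : ℕ} (π : Equiv.Perm (Fin n)) (σ : Equiv.Perm (Fin k)) : Prop :=
  ¬ Contains σ π

noncomputable def p123 : Equiv.Perm (Fin 3) := Equiv.ofBijective ![0, 1, 2] (by decide)
noncomputable def p132 : Equiv.Perm (Fin 3) := Equiv.ofBijective ![0, 2, 1] (by decide)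
noncomputable def p213 : Equiv.Perm (Fin 3) := Equiv.ofBijective ![1, 0, 2] (by decide)
noncomputable def p231 : Equiv.Perm (Fin 3) := Equiv.ofBijective ![1, 2, 0] (by decide)
noncomputable def p312 : Equiv.Perm (Fin 3) := Equiv.ofBijective ![2, 0, 1] (by decide)
noncomputable def p321 : Equiv.Perm (Fin 3) := Equiv.ofBijective ![2, 1, 0] (by decide)

/-- The direct sum `π ⊕ τ` of two permutations. -/
def directSum {n m : ℕ} (π : Equiv.Perm (Fin n)) (τ : Equiv.Perm (Fin m)) :
    Equiv.Perm (Fin (n + m)) :=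
  finSumFinEquiv.permCongr (Equiv.sumCongr π τ)

/-- A permutation is irreducible if it is not a direct sum of two nonempty permutations. -/
def IrreduciblePerm {n : ℕ} (π : Equiv.Perm (Fin n)) : Prop :=
  ¬ ∃ (a b : ℕ) (_ : 0 < a) (_ : 0 < b) (h : a + b = n)
      (σ : Equiv.Perm (Fin a)) (τ : Equiv.Perm (Fin b)),
      π = (finCongr h).permCongr (directSum σ τ)

/-- A permutation is cyclic if its cycle decomposition is a single cycle of full length,
i.e. it acts transitively. -/
def IsCyclicPerm {n : ℕ} (π : Equiv.Perm (Fin n)) : Prop :=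
  ∀ x y : Fin n, ∃ k : ℕ, (⇑π)^[k] x = y

open Equiv Function

section FundamentalBijection

variable {n : ℕ} {π : Perm (Fin n)}

theorem iterate_mod_minimalPeriod (x : Fin n) (k : ℕ) :
    (⇑π)^[k % minimalPeriod π x] x = (⇑π)^[k] x :=
  iterate_mod_minimalPeriod_eq

theorem minimalPeriod_perm_pos (π : Perm (Fin n)) (x : Fin n) : 0 < minimalPeriod π x :=
  minimalPeriod_pos_of_mem_periodicPts (π.injective.mem_periodicPts x)

theorem forall_lt_iterate_le_iff (x : Fin n) :
    (∀ k < n, (⇑π)^[k] x ≤ x) ↔ ∀ y, π.SameCycle x y → y ≤ x := by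
  constructor
  · intro h y hy
    obtain ⟨k, rfl⟩ := hy.exists_nat_pow_eq
    rw [← Perm.iterate_eq_pow, ← iterate_mod_minimalPeriod]
    refine h _ ((Nat.mod_lt _ (minimalPeriod_perm_pos π x)).trans_le ?_)
    simpa using minimalPeriod_le_card (f := ⇑π) (x := x)
  · intro h k _
    apply h
    rw [Perm.iterate_eq_pow]
    exact Perm.sameCycle_pow_right.2 (Perm.SameCycle.refl _ _)

theorem mem_fundWord (π : Perm (Fin n)) (y : Fin n) : y ∈ fundWord π := by
  classical
  obtain ⟨x, hx, hmax⟩ := (Finset.univ.filter fun x => π.SameCycle y x).exists_max_image id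
    ⟨y, by simp [Perm.SameCycle.refl]⟩
  simp only [Finset.mem_filter, Finset.mem_univ, true_and, id] at hx hmax
  simp only [fundWord, List.mem_flatMap, List.mem_filter, List.mem_finRange, true_and,
    List.all_eq_true, List.mem_range, decide_eq_true_eq, List.mem_map]
  refine ⟨x, (forall_lt_iterate_le_iff x).2 fun z hz => hmax z (hx.trans hz), ?_⟩
  obtain ⟨k, hk⟩ := hx.symm.exists_nat_pow_eq
  refine ⟨_, Nat.mod_lt k (minimalPeriod_perm_pos π x), ?_⟩
  rw [iterate_mod_minimalPeriod, Perm.iterate_eq_pow, hk]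

theorem nodup_fundWord (π : Perm (Fin n)) : (fundWord π).Nodup := by
  refine List.nodup_flatMap.2 ⟨fun x _ => ?_, ?_⟩
  · refine List.Nodup.map_on (fun a ha b hb h => ?_) List.nodup_range
    exact iterate_injOn_Iio_minimalPeriod (List.mem_range.1 ha) (List.mem_range.1 hb) h
  · refine List.Pairwise.imp_of_mem ?_ ((List.nodup_finRange n).filter _)
    intro x y hx hy hxy z hzx hzy
    simp only [List.mem_filter, List.mem_finRange, true_and, List.all_eq_true, List.mem_range,
      decide_eq_true_eq, List.mem_map] at hx hy hzx hzy
    obtain ⟨a, -, rfl⟩ := hzx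
    obtain ⟨b, -, hb⟩ := hzy
    rw [Perm.iterate_eq_pow, Perm.iterate_eq_pow] at hb
    have hc : π.SameCycle x y := by
      have := Perm.sameCycle_pow_right (n := a).2 (Perm.SameCycle.refl π x)
      rw [← hb] at this
      exact Perm.sameCycle_pow_right.1 this
    exact hxy (le_antisymm ((forall_lt_iterate_le_iff y).1 hy x hc.symm)
      ((forall_lt_iterate_le_iff x).1 hx y hc))

theorem length_fundWord (π : Perm (Fin n)) : (fundWord π).length = n := by
  have h : (fundWord π).toFinset = Finset.univ := by
    ext y; simp [mem_fundWord]
  rw [← List.toFinset_card_of_nodup (nodup_fundWord π), h, Finset.card_fin]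

theorem theta_eq_self_iff : theta π = π ↔ fundWord π = (List.finRange n).map π := by
  have hinj : Injective fun σ : Perm (Fin n) => (List.finRange n).map ⇑σ := by
    intro σ τ h
    ext x
    rw [List.map_inj_left.1 h x (List.mem_finRange x)]
  have hex : ∃ σ : Perm (Fin n), (List.finRange n).map ⇑σ = fundWord π := by
    let f : Fin n → Fin n := fun i => (fundWord π)[i]'(by rw [length_fundWord]; exact i.2)
    have hf : Injective f := fun i j h =>
      Fin.ext ((nodup_fundWord π).getElem_inj_iff.1 h)
    refine ⟨Equiv.ofBijective f (Finite.injective_iff_bijective.1 hf), ?_⟩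
    exact List.ext_getElem (by simp [length_fundWord]) (by simp [f])
  constructor
  · intro h
    have := invFun_eq hex
    change (List.finRange n).map ⇑(theta π) = _ at this
    rw [← this, h]
  · intro h
    rw [theta, permOfWord, h]
    exact leftInverse_invFun hinj π

theorem exists_block_of_lt_length_flatMap {α β : Type*} (f : α → List β) (l : List α) (i : ℕ)
    (hi : i < (l.flatMap f).length) :
    ∃ x ∈ l, ∃ p k, i = p + k ∧ k < (f x).length ∧
      ∀ j < (f x).length, (l.flatMap f)[p + j]? = (f x)[j]? := by
  induction l generalizing i with
  | nil => simp at hi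
  | cons a l ih =>
    rw [List.flatMap_cons, List.length_append] at hi
    by_cases h : i < (f a).length
    · refine ⟨a, by simp, 0, i, by simp, h, fun j hj => ?_⟩
      rw [List.flatMap_cons, List.getElem?_append_left (by omega), Nat.zero_add]
    · obtain ⟨x, hx, p, k, hpk, hk, hj⟩ := ih (i - (f a).length) (by omega)
      refine ⟨x, by simp [hx], (f a).length + p, k, by omega, hk, fun j hjl => ?_⟩
      rw [List.flatMap_cons, List.getElem?_append_right (by omega), ← hj j hjl]
      congr 1; omega

/-- Involutions of `Fin n` moving each point by at most one. -/
def IsAdjacentInvolution (π : Perm (Fin n)) : Prop :=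
  ∀ x, (π x : ℕ) ≤ x + 1 ∧ π (π x) = x

theorem isAdjacentInvolution_of_fundWord_eq (h : fundWord π = (List.finRange n).map π) :
    IsAdjacentInvolution π := by
  intro i
  obtain ⟨x, hx, p, k, hpk, hk, hblock⟩ := exists_block_of_lt_length_flatMap
    (fun x => (List.range (minimalPeriod π x)).map fun k => (⇑π)^[k] x) _ i
    (show (i : ℕ) < (fundWord π).length by rw [length_fundWord]; exact i.2)
  simp only [List.length_map, List.length_range] at hk hblock
  change ∀ j < _, (fundWord π)[p + j]? = _ at hblock
  simp only [List.mem_filter, List.mem_finRange, true_and, List.all_eq_true, List.mem_range,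
      decide_eq_true_eq] at hx
  have hval : ∀ j < minimalPeriod π x, ∃ hj : p + j < n, π ⟨p + j, hj⟩ = (⇑π)^[j] x := by
    intro j hj
    have := hblock j hj
    rw [h] at this
    have hlt : p + j < n := by
      by_contra hc
      rw [List.getElem?_eq_none (by simpa using hc)] at this
      simp [hj] at this
    exact ⟨hlt, by simpa [hj, hlt] using this⟩
  have hnext : ∀ j, j + 1 < minimalPeriod π x → ((⇑π)^[j] x : ℕ) = p + j + 1 := by
    intro j hj
    obtain ⟨h1, e1⟩ := hval (j + 1) hj
    rw [iterate_succ_apply'] at e1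
    rw [← π.injective e1]
    rfl
  have hL : minimalPeriod π x ≤ 2 := by
    by_contra hc
    have h0 := hnext 0 (by omega)
    have h1 := hnext 1 (by omega)
    have := (forall_lt_iterate_le_iff x).1 hx (π x)
      (Perm.sameCycle_apply_right.2 (Perm.SameCycle.refl _ _))
    simp only [iterate_one, iterate_zero, id] at h0 h1
    rw [Fin.le_def] at this
    omega
  have hper : (⇑π)^[minimalPeriod π x] x = x := iterate_minimalPeriod
  have hpos := minimalPeriod_perm_pos π x
  obtain hL | hL : minimalPeriod π x = 1 ∨ minimalPeriod π x = 2 := by omega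
  · obtain ⟨h0, e0⟩ := hval 0 (by omega)
    have hi : i = ⟨p + 0, h0⟩ := Fin.ext (by simp only; omega)
    rw [← hi] at e0
    rw [hL] at hper
    simp only [iterate_one, iterate_zero, id] at e0 hper
    have : i = x := π.injective (e0.trans hper.symm)
    subst this
    simp [e0]
  · obtain ⟨h0, e0⟩ := hval 0 (by omega)
    obtain ⟨h1, e1⟩ := hval 1 (by omega)
    have n0 := hnext 0 (by omega)
    rw [hL] at hper
    simp only [iterate_succ_apply, iterate_zero, id] at e0 e1 hper n0
    have hx1 : x = ⟨p + 1, h1⟩ := Fin.ext n0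
    have hx0 : π x = ⟨p + 0, h0⟩ := π.injective (hper.trans e0.symm)
    obtain hk0 | hk1 : k = 0 ∨ k = 1 := by omega
    · have hi : i = ⟨p + 0, h0⟩ := Fin.ext (by simp only; omega)
      rw [hi, e0]
      exact ⟨by simp [hx1], hx0⟩
    · have hi : i = x := by rw [hx1]; exact Fin.ext (by simp; omega)
      rw [hi, hper, hx0, hx1]
      exact ⟨by simp only; omega, rfl⟩

theorem IsAdjacentInvolution.le_apply (h : IsAdjacentInvolution π) (x : Fin n) :
    (x : ℕ) ≤ π x + 1 := by
  simpa [(h x).2] using (h (π x)).1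

theorem IsAdjacentInvolution.iterate_le_iff (h : IsAdjacentInvolution π) (x : Fin n) :
    (∀ k < n, (⇑π)^[k] x ≤ x) ↔ π x ≤ x := by
  rw [forall_lt_iterate_le_iff]
  refine ⟨fun H => H _ (Perm.sameCycle_apply_right.2 (Perm.SameCycle.refl _ _)), fun H y hy => ?_⟩
  obtain ⟨k, rfl⟩ := hy.exists_nat_pow_eq
  rw [← Perm.iterate_eq_pow]
  have hinv : Involutive π := fun x => (h x).2
  obtain hk | hk := Nat.even_or_odd k
  · rw [hinv.iterate_even hk]; rfl
  · rwa [hinv.iterate_odd hk]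

theorem IsAdjacentInvolution.fundWord_eq (h : IsAdjacentInvolution π) :
    fundWord π = (List.finRange n).map π := by
  set f : Fin n → List (Fin n) := fun x =>
    if π x ≤ x then (List.range (minimalPeriod π x)).map fun k => (⇑π)^[k] x else [] with hf
  have hword : fundWord π = (List.finRange n).flatMap f := by
    rw [fundWord]
    induction List.finRange n with
    | nil => rfl
    | cons x l ih =>
      rw [List.filter_cons, List.flatMap_cons, ← ih]
      simp only [hf, List.all_eq_true, List.mem_range, decide_eq_true_eq, h.iterate_le_iff]
      split_ifs <;> simp
  have hperiod : ∀ x, minimalPeriod π x = if π x = x then 1 else 2 := by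
    intro x
    split_ifs with hx
    · exact minimalPeriod_eq_one_iff_isFixedPt.2 hx
    · have h2 : minimalPeriod π x ∣ 2 := IsPeriodicPt.minimalPeriod_dvd (h x).2
      obtain h1 | h1 := (Nat.dvd_prime Nat.prime_two).1 h2
      · exact absurd (minimalPeriod_eq_one_iff_isFixedPt.1 h1) hx
      · exact h1
  have htake : ∀ (g : Fin n → List (Fin n)) (k : ℕ) (hk : k < n),
      ((List.finRange n).take (k + 1)).flatMap g =
        ((List.finRange n).take k).flatMap g ++ g ⟨k, hk⟩ := by
    intro g k hk
    rw [List.take_add_one, List.flatMap_append]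
    simp [hk]
  have key : ∀ k ≤ n, (∀ hk : k < n, k ≤ π ⟨k, hk⟩) →
      ((List.finRange n).take k).flatMap f = ((List.finRange n).take k).flatMap fun x => [π x] := by
    intro k
    induction k using Nat.strong_induction_on with
    | _ k ih =>
      intro hkn hk
      obtain _ | k := k
      · simp
      rw [htake f k hkn, htake _ k hkn]
      have hle : π ⟨k, hkn⟩ ≤ ⟨k, hkn⟩ := by
        by_contra hc
        have h1 := (h ⟨k, hkn⟩).1
        have h2 := (h ⟨k, hkn⟩).2
        rw [Fin.le_def] at hc
        simp only at hc h1
        have he : π ⟨k, hkn⟩ = ⟨k + 1, by have := (π ⟨k, hkn⟩).2; omega⟩ :=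
          Fin.ext (by simp only; omega)
        have := hk (by have := (π ⟨k, hkn⟩).2; omega)
        rw [← he, h2] at this
        simp at this
      by_cases hfix : π ⟨k, hkn⟩ = ⟨k, hkn⟩
      · rw [ih k (by omega) (by omega) (fun _ => by rw [hfix])]
        simp [hf, hperiod, hfix]
      · have h1 := h.le_apply ⟨k, hkn⟩
        have h3 : (π ⟨k, hkn⟩ : ℕ) ≠ k := fun hc => hfix (Fin.ext hc)
        rw [Fin.le_def] at hle
        simp only at hle h1
        obtain _ | k := k
        · omega
        have he : π ⟨k + 1, hkn⟩ = ⟨k, by omega⟩ := Fin.ext (by simp only; omega)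
        have he' : π ⟨k, by omega⟩ = ⟨k + 1, hkn⟩ := by rw [← he]; exact (h _).2
        rw [htake f k (by omega), htake _ k (by omega),
          ih k (by omega) (by omega) (fun _ => by rw [he']; simp)]
        simp [hf, hperiod, he, he']
  have := key n le_rfl (fun hk => absurd hk (lt_irrefl n))
  rw [List.take_of_length_le (by simp)] at this
  rw [hword, this, ← List.map_eq_flatMap]

theorem theta_eq_self_iff_isAdjacentInvolution : theta π = π ↔ IsAdjacentInvolution π :=
  theta_eq_self_iff.trans
    ⟨isAdjacentInvolution_of_fundWord_eq, IsAdjacentInvolution.fundWord_eq⟩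

end FundamentalBijection

/-- Involutions of `ℕ` supported on `{0, …, n - 1}` moving each point by at most one. -/
def natAdjacentInvolutions (n : ℕ) : Set (Perm ℕ) :=
  {π | (∀ x, ¬ x < n → π x = x) ∧ ∀ x, π x ≤ x + 1 ∧ π (π x) = x}

theorem natAdjacentInvolutions_of_le_one {n : ℕ} (hn : n ≤ 1) :
    natAdjacentInvolutions n = {1} := by
  ext π
  simp only [natAdjacentInvolutions, Set.mem_ofPred_eq, Set.mem_singleton_iff]
  refine ⟨fun h => ?_, by rintro rfl; simp⟩
  ext x
  by_cases hx : x < n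
  · by_contra hc
    have h0 := h.1 (π x) (by simp at hc; omega)
    exact hc (π.injective h0)
  · exact h.1 x hx

theorem natAdjacentInvolutions_add_two (n : ℕ) :
    natAdjacentInvolutions (n + 2) = natAdjacentInvolutions (n + 1) ∪
      (· * swap n (n + 1)) '' natAdjacentInvolutions n := by
  ext π
  simp only [Set.mem_union, Set.mem_image]
  constructor
  · intro h
    by_cases hfix : π (n + 1) = n + 1
    · refine Or.inl ⟨fun x hx => ?_, h.2⟩
      obtain rfl | hx : x = n + 1 ∨ ¬ x < n + 2 := by omega
      · exact hfix
      · exact h.1 x hx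
    · right
      have hlt : π (n + 1) < n + 2 := by
        by_contra hc
        have := π.injective (h.1 _ hc)
        omega
      have h1 := (h.2 (π (n + 1))).1
      rw [(h.2 _).2] at h1
      have he : π (n + 1) = n := by omega
      have he' : π n = n + 1 := by rw [← congrArg π he]; exact (h.2 _).2
      have hval : ∀ x, x ≠ n → x ≠ n + 1 → (π * swap n (n + 1)) x = π x := by
        intro x hx hx'
        rw [Perm.mul_apply, swap_apply_of_ne_of_ne hx hx']
      have hn0 : (π * swap n (n + 1)) n = n := by simp [he]
      have hn1 : (π * swap n (n + 1)) (n + 1) = n + 1 := by simp [he']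
      refine ⟨π * swap n (n + 1), ⟨fun x hx => ?_, fun x => ?_⟩, by simp [mul_assoc]⟩
      · by_cases hx0 : x = n
        · rw [hx0, hn0]
        by_cases hx1 : x = n + 1
        · rw [hx1, hn1]
        rw [hval x hx0 hx1, h.1 x (by omega)]
      · by_cases hx0 : x = n
        · simp only [hx0, hn0]; simp
        by_cases hx1 : x = n + 1
        · simp only [hx1, hn1]; simp
        have a0 : π x ≠ n := fun hc => hx1 (π.injective (hc.trans he.symm))
        have a1 : π x ≠ n + 1 := fun hc => hx0 (π.injective (hc.trans he'.symm))
        rw [hval x hx0 hx1, hval _ a0 a1]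
        exact h.2 x
  · rintro (h | ⟨σ, h, rfl⟩)
    · exact ⟨fun x hx => h.1 x (by omega), h.2⟩
    · have e0 : σ n = n := h.1 n (by omega)
      have e1 : σ (n + 1) = n + 1 := h.1 (n + 1) (by omega)
      have hval : ∀ x, x ≠ n → x ≠ n + 1 → (σ * swap n (n + 1)) x = σ x := by
        intro x hx hx'
        rw [Perm.mul_apply, swap_apply_of_ne_of_ne hx hx']
      refine ⟨fun x hx => ?_, fun x => ?_⟩
      · exact (hval x (by omega) (by omega)).trans (h.1 x (by omega))
      · by_cases hx0 : x = n
        · simp [hx0, e0, e1]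
        by_cases hx1 : x = n + 1
        · simp [hx1, e0, e1]; omega
        have a0 : σ x ≠ n := fun hc => hx0 (σ.injective (hc.trans e0.symm))
        have a1 : σ x ≠ n + 1 := fun hc => hx1 (σ.injective (hc.trans e1.symm))
        rw [hval x hx0 hx1, hval _ a0 a1]
        exact h.2 x

theorem encard_natAdjacentInvolutions (n : ℕ) :
    (natAdjacentInvolutions n).encard = Nat.fib (n + 1) := by
  induction n using Nat.twoStepInduction with
  | zero => simp [natAdjacentInvolutions_of_le_one]
  | one => simp [natAdjacentInvolutions_of_le_one]
  | more n ih0 ih1 =>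
    rw [natAdjacentInvolutions_add_two, Set.encard_union_eq, ih1,
      (mul_left_injective _).encard_image, ih0, Nat.fib_add_two (n := n + 1)]
    · push_cast; ring
    · rw [Set.disjoint_left]
      rintro _ h ⟨σ, hσ, rfl⟩
      have h1 := h.1 (n + 1) (by omega)
      have h2 := hσ.1 n (by omega)
      simp [h2] at h1

theorem card_isAdjacentInvolution (n : ℕ) :
    Nat.card {π : Perm (Fin n) // IsAdjacentInvolution π} = Nat.fib (n + 1) := by
  let e := (Fin.equivSubtype (n := n)).permCongr.trans
    (Perm.subtypeEquivSubtypePerm fun x : ℕ => x < n)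
  have he : ∀ (π : Perm (Fin n)) (x : Fin n), (e π).1 x = π x := by
    intro π x
    simp only [e, Equiv.trans_apply]
    rw [Perm.subtypeEquivSubtypePerm_apply_of_mem (p := fun x : ℕ => x < n) _ x.2]
    rfl
  have hfix : ∀ (π : Perm (Fin n)) (x : ℕ), ¬ x < n → (e π).1 x = x :=
    fun π => (e π).2
  have hiff : ∀ π : Perm (Fin n), IsAdjacentInvolution π ↔
      ∀ x, (e π).1 x ≤ x + 1 ∧ (e π).1 ((e π).1 x) = x := by
    intro π
    constructor
    · intro h x
      by_cases hx : x < n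
      · have := h ⟨x, hx⟩
        rw [show x = ((⟨x, hx⟩ : Fin n) : ℕ) from rfl, he, he, this.2]
        exact ⟨this.1, rfl⟩
      · simp [hfix π x hx]
    · intro h x
      have := h x
      rw [he, he] at this
      exact ⟨this.1, Fin.ext this.2⟩
  have hcard := Nat.card_congr ((e.subtypeEquiv hiff).trans
    (Equiv.subtypeSubtypeEquivSubtypeInter (fun f : Perm ℕ => ∀ x, ¬ x < n → f x = x)
      (fun f : Perm ℕ => ∀ x, f x ≤ x + 1 ∧ f (f x) = x)))
  rw [hcard]
  change (natAdjacentInvolutions n).ncard = _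
  rw [Set.ncard, encard_natAdjacentInvolutions, ENat.toNat_natCast]

section Patterns

variable {n : ℕ} {π : Perm (Fin n)}

theorem contains_iff_exists {σ : Perm (Fin 3)} :
    Contains σ π ↔ ∃ a b c : Fin n, a < b ∧ b < c ∧ (π a < π b ↔ σ 0 < σ 1) ∧
      (π b < π c ↔ σ 1 < σ 2) ∧ (π a < π c ↔ σ 0 < σ 2) := by
  constructor
  · rintro ⟨f, hf, h⟩
    exact ⟨f 0, f 1, f 2, hf (by decide), hf (by decide), h _ _, h _ _, h _ _⟩
  · rintro ⟨a, b, c, hab, hbc, h1, h2, h3⟩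
    have flip : ∀ {x y : Fin n} {i j : Fin 3}, x ≠ y → i ≠ j → (π x < π y ↔ σ i < σ j) →
        (π y < π x ↔ σ j < σ i) := by
      intro x y i j hxy hij h
      have h1 : π x ≠ π y := π.injective.ne hxy
      have h2 : σ i ≠ σ j := σ.injective.ne hij
      rw [← not_iff_not, not_lt, not_lt, h1.le_iff_lt, h2.le_iff_lt, h]
    refine ⟨![a, b, c], ?_, ?_⟩
    · intro i j hij
      fin_cases i <;> fin_cases j <;> simp_all [hab.trans hbc]
    · intro i j
      fin_cases i <;> fin_cases j <;> simp
      · exact h1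
      · exact h3
      · exact flip hab.ne (by decide) h1
      · exact h2
      · exact flip (hab.trans hbc).ne (by decide) h3
      · exact flip hbc.ne (by decide) h2

theorem IsAdjacentInvolution.apply_of_inversion (h : IsAdjacentInvolution π) {a b : Fin n}
    (hab : a < b) (hπ : π b < π a) : (b : ℕ) = a + 1 ∧ π a = b := by
  have h1 := (h a).1
  have h2 := h.le_apply b
  rw [Fin.lt_def] at hab hπ
  exact ⟨by omega, Fin.ext (by omega)⟩

theorem IsAdjacentInvolution.avoids_of_gt (h : IsAdjacentInvolution π) {σ : Perm (Fin 3)}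
    (hσ : σ 2 < σ 0) : Avoids π σ := by
  intro hc
  obtain ⟨a, b, c, hab, hbc, -, -, h3⟩ := contains_iff_exists.1 hc
  have hne : π a ≠ π c := π.injective.ne (hab.trans hbc).ne
  have hlt : π c < π a :=
    lt_of_le_of_ne (not_lt.1 fun hh => absurd (h3.1 hh) hσ.asymm) hne.symm
  have := (h.apply_of_inversion (hab.trans hbc) hlt).1
  rw [Fin.lt_def] at hab hbc
  omega

theorem IsAdjacentInvolution.eq_one (h : IsAdjacentInvolution π)
    (hasc : ∀ x : Fin n, (π x : ℕ) ≠ x + 1) : π = 1 := by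
  ext x
  have h1 := (h x).1
  have h2 := h.le_apply x
  have h3 := hasc x
  have h4 := hasc (π x)
  rw [(h x).2] at h4
  simp only [Perm.one_apply]
  omega

theorem IsAdjacentInvolution.eq_swap (h : IsAdjacentInvolution π) {a b : Fin n}
    (hπ : π a = b)
    (hasc : ∀ x : Fin n, x ≠ a → (π x : ℕ) ≠ x + 1) : π = swap a b := by
  have hb : π b = a := by rw [← hπ]; exact (h a).2
  ext x
  by_cases hxa : x = a
  · simp [hxa, hπ]
  by_cases hxb : x = b
  · simp [hxb, hb]
  rw [swap_apply_of_ne_of_ne hxa hxb]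
  have h1 := (h x).1
  have h2 := h.le_apply x
  have h3 := hasc x hxa
  have h4 := hasc (π x) (fun hc => hxb (π.injective (hc.trans hb.symm)))
  rw [(h x).2] at h4
  omega

theorem isAdjacentInvolution_one : IsAdjacentInvolution (1 : Perm (Fin n)) :=
  fun x => by simp

theorem isAdjacentInvolution_swap {a b : Fin n} (hab : (b : ℕ) = a + 1) :
    IsAdjacentInvolution (swap a b) := by
  intro x
  refine ⟨?_, by simp⟩
  rw [swap_apply_def]
  split_ifs with h1 h2
  · subst h1; omega
  · subst h2; omega
  · omega

theorem ncard_isAdjacentInvolution_avoids {σ : Perm (Fin 3)} {a b : Fin n}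
    (hab : (b : ℕ) = a + 1) (hone : Avoids (1 : Perm (Fin n)) σ) (hswap : Avoids (swap a b) σ)
    (hasc : ∀ π : Perm (Fin n), IsAdjacentInvolution π → Avoids π σ →
      ∀ x : Fin n, x ≠ a → (π x : ℕ) ≠ x + 1) :
    Nat.card {π : Perm (Fin n) // IsAdjacentInvolution π ∧ Avoids π σ} = 2 := by
  have hset : {π : Perm (Fin n) | IsAdjacentInvolution π ∧ Avoids π σ} = {1, swap a b} := by
    ext π
    simp only [Set.mem_ofPred_eq, Set.mem_insert_iff, Set.mem_singleton_iff]
    constructor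
    · rintro ⟨h, hav⟩
      by_cases ha : (π a : ℕ) = a + 1
      · exact Or.inr (h.eq_swap (Fin.ext (by omega)) (hasc π h hav))
      · refine Or.inl (h.eq_one fun x => ?_)
        by_cases hx : x = a
        · rwa [hx]
        · exact hasc π h hav x hx
    · rintro (rfl | rfl)
      · exact ⟨isAdjacentInvolution_one, hone⟩
      · exact ⟨isAdjacentInvolution_swap hab, hswap⟩
  change Set.ncard {π : Perm (Fin n) | IsAdjacentInvolution π ∧ Avoids π σ} = 2
  rw [hset, Set.ncard_pair]
  intro hc
  have := congrArg (fun τ : Perm (Fin n) => (τ a : ℕ)) hc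
  simp at this
  omega

theorem card_isAdjacentInvolution_avoids_p132 (hn : 2 ≤ n) :
    Nat.card {π : Perm (Fin n) // IsAdjacentInvolution π ∧ Avoids π p132} = 2 := by
  have hno : ∀ τ : Perm (Fin n), IsAdjacentInvolution τ →
      (∀ x y : Fin n, 0 < (x : ℕ) → (y : ℕ) = x + 1 → τ x ≠ y) → Avoids τ p132 := by
    intro τ hτ hasc hc
    obtain ⟨a, b, c, hab, hbc, -, h2, -⟩ := contains_iff_exists.1 hc
    have hlt : τ c < τ b := lt_of_le_of_ne
      (not_lt.1 fun hh => absurd (h2.1 hh) (by simp [p132])) (τ.injective.ne hbc.ne')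
    obtain ⟨e1, e2⟩ := hτ.apply_of_inversion hbc hlt
    exact hasc b c (by rw [Fin.lt_def] at hab; omega) e1 e2
  refine ncard_isAdjacentInvolution_avoids (a := ⟨0, by omega⟩) (b := ⟨1, by omega⟩) rfl
    (hno _ isAdjacentInvolution_one ?_) (hno _ (isAdjacentInvolution_swap rfl) ?_) ?_
  · rintro x y - hxy rfl
    simp at hxy
  · intro x y hx hxy he
    rw [swap_apply_def] at he
    split_ifs at he with h1 h2
    · simp [h1] at hx
    · simp [← he] at hxy
    · omega
  · intro π h hav x hx hπ
    apply hav
    have hx0 : 0 < (x : ℕ) := Nat.pos_of_ne_zero fun hc => hx (Fin.ext hc)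
    have hlt : (x : ℕ) + 1 < n := hπ ▸ (π x).2
    have hy : π x = ⟨x + 1, hlt⟩ := Fin.ext hπ
    have hy' : π ⟨x + 1, hlt⟩ = x := by rw [← hy]; exact (h x).2
    have h0 := (h ⟨0, by omega⟩).1
    have hne : π ⟨0, by omega⟩ ≠ x := fun hc => by
      simpa using π.injective (hc.trans hy'.symm)
    have hne' : (π ⟨0, by omega⟩ : ℕ) ≠ x := fun hc => hne (Fin.ext hc)
    simp only at h0
    refine contains_iff_exists.2 ⟨⟨0, by omega⟩, x, ⟨x + 1, hlt⟩, hx0, ?_, ?_, ?_, ?_⟩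
    · simp [Fin.lt_def]
    · exact iff_of_true (Fin.lt_def.2 (by omega)) (by simp [p132])
    · exact iff_of_false (by simp [hy, hy', Fin.le_def]) (by simp [p132])
    · exact iff_of_true (Fin.lt_def.2 (by rw [hy']; omega)) (by simp [p132])

theorem card_isAdjacentInvolution_avoids_p213 (hn : 2 ≤ n) :
    Nat.card {π : Perm (Fin n) // IsAdjacentInvolution π ∧ Avoids π p213} = 2 := by
  have hno : ∀ τ : Perm (Fin n), IsAdjacentInvolution τ →
      (∀ x y : Fin n, (y : ℕ) + 1 < n → (y : ℕ) = x + 1 → τ x ≠ y) → Avoids τ p213 := by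
    intro τ hτ hasc hc
    obtain ⟨a, b, c, hab, hbc, h1, -, -⟩ := contains_iff_exists.1 hc
    have hlt : τ b < τ a := lt_of_le_of_ne
      (not_lt.1 fun hh => absurd (h1.1 hh) (by simp [p213])) (τ.injective.ne hab.ne')
    obtain ⟨e1, e2⟩ := hτ.apply_of_inversion hab hlt
    exact hasc a b (by rw [Fin.lt_def] at hbc; omega) e1 e2
  have hsucc : ((⟨n - 1, by omega⟩ : Fin n) : ℕ) = ((⟨n - 2, by omega⟩ : Fin n) : ℕ) + 1 := by
    simp only; omega
  refine ncard_isAdjacentInvolution_avoids (a := ⟨n - 2, by omega⟩) (b := ⟨n - 1, by omega⟩)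
    hsucc (hno _ isAdjacentInvolution_one ?_) (hno _ (isAdjacentInvolution_swap hsucc) ?_) ?_
  · rintro x y - hxy rfl
    simp at hxy
  · intro x y hx hxy he
    rw [swap_apply_def] at he
    split_ifs at he with h1 h2
    · simp [← he] at hx; omega
    · simp [← he, h2] at hxy; omega
    · omega
  · intro π h hav x hx hπ
    apply hav
    have hx0 : (x : ℕ) ≠ n - 2 := fun hc => hx (Fin.ext hc)
    have hlt : (x : ℕ) + 1 < n := hπ ▸ (π x).2
    have hy : π x = ⟨x + 1, hlt⟩ := Fin.ext hπ
    have hy' : π ⟨x + 1, hlt⟩ = x := by rw [← hy]; exact (h x).2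
    have h0 := h.le_apply ⟨n - 1, by omega⟩
    have hne : π ⟨n - 1, by omega⟩ ≠ π x := by
      refine π.injective.ne fun hc => ?_
      rw [← hc] at hlt
      simp only at hlt
      omega
    have hne' : (π ⟨n - 1, by omega⟩ : ℕ) ≠ x + 1 := fun hc => hne (Fin.ext (hc.trans hπ.symm))
    simp only at h0
    refine contains_iff_exists.2 ⟨x, ⟨x + 1, hlt⟩, ⟨n - 1, by omega⟩, ?_, ?_, ?_, ?_, ?_⟩
    · simp [Fin.lt_def]
    · simp [Fin.lt_def]; omega
    · exact iff_of_false (by simp [hy, hy', Fin.le_def]) (by simp [p213])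
    · exact iff_of_true (Fin.lt_def.2 (by rw [hy']; omega)) (by simp [p213])
    · exact iff_of_true (Fin.lt_def.2 (by omega)) (by simp [p213])

theorem IsAdjacentInvolution.contains_p123 (h : IsAdjacentInvolution π) (hn : 5 ≤ n) :
    Contains p123 π := by
  have lt_of_add_two : ∀ x y : Fin n, (y : ℕ) = x + 2 → π x < π y := by
    intro x y hxy
    by_contra hc
    have hlt : x < y := by rw [Fin.lt_def]; omega
    have := (h.apply_of_inversion hlt
      (lt_of_le_of_ne (not_lt.1 hc) (π.injective.ne hlt.ne'))).1
    omega
  have h1 := lt_of_add_two ⟨0, by omega⟩ ⟨2, by omega⟩ rfl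
  have h2 := lt_of_add_two ⟨2, by omega⟩ ⟨4, by omega⟩ rfl
  refine contains_iff_exists.2 ⟨⟨0, by omega⟩, ⟨2, by omega⟩, ⟨4, by omega⟩, ?_, ?_, ?_, ?_, ?_⟩
  · simp [Fin.lt_def]
  · simp [Fin.lt_def]
  · simpa [p123] using h1
  · simpa [p123] using h2
  · simpa [p123] using h1.trans h2

theorem card_isAdjacentInvolution_avoids_of_gt {σ : Perm (Fin 3)} (hσ : σ 2 < σ 0) :
    Nat.card {π : Perm (Fin n) // IsAdjacentInvolution π ∧ Avoids π σ} = Nat.fib (n + 1) := by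
  rw [← card_isAdjacentInvolution]
  exact Nat.card_congr (Equiv.subtypeEquivRight fun π =>
    ⟨fun h => h.1, fun h => ⟨h, h.avoids_of_gt hσ⟩⟩)

end Patterns

/-- for `n ≥ 5`, the number of `θ`-fixed permutations avoiding `σ` is
`F_{n+1}` for `σ ∈ {231, 312, 321}`, `2` for `σ ∈ {132, 213}`, and `0` for `σ = 123`. -/
theorem f1_n (n : ℕ) (hn : 5 ≤ n) :
    Nat.card {π : Equiv.Perm (Fin n) // theta π = π ∧ Avoids π p231} = Nat.fib (n + 1) ∧
    Nat.card {π : Equiv.Perm (Fin n) // theta π = π ∧ Avoids π p312} = Nat.fib (n + 1) ∧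
    Nat.card {π : Equiv.Perm (Fin n) // theta π = π ∧ Avoids π p321} = Nat.fib (n + 1) ∧
    Nat.card {π : Equiv.Perm (Fin n) // theta π = π ∧ Avoids π p132} = 2 ∧
    Nat.card {π : Equiv.Perm (Fin n) // theta π = π ∧ Avoids π p213} = 2 ∧
    Nat.card {π : Equiv.Perm (Fin n) // theta π = π ∧ Avoids π p123} = 0 := by
  simp only [theta_eq_self_iff_isAdjacentInvolution]
  refine ⟨card_isAdjacentInvolution_avoids_of_gt (by simp [p231]),
    card_isAdjacentInvolution_avoids_of_gt (by simp [p312]),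
    card_isAdjacentInvolution_avoids_of_gt (by simp [p321]),
    card_isAdjacentInvolution_avoids_p132 (by omega),
    card_isAdjacentInvolution_avoids_p213 (by omega), ?_⟩
  rw [Nat.card_eq_zero]
  exact Or.inl ⟨fun π => π.2.2 (π.2.1.contains_p123 hn)⟩
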